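/- In the model-based fictitious play under Assumption 1, the estimates of continuation payoffs track the minimax values associated with the beliefs on Q-functions: for every state s ∈ S and each i ∈ {1,2}, lim_{k→∞} (v̂_{i,k}(s) − val_i(Q̂_{i,s,k})) = 0. -/

import Mathlib

open Finset Filter Topology

/-- Model-based fictitious play in a finite two-player zero-sum stochastic game. -/
structure MBFP (S A1 A2 : Type) [Fintype S] [Fintype A1] [Fintype A2]
    [Nonempty S] [Nonempty A1] [Nonempty A2]
    [DecidableEq S] [DecidableEq A1] [DecidableEq A2] where
  /-- stage payoff of player 1 -/
  r1 : S → A1 → A2 → ℝ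
  /-- stage payoff of player 2 -/
  r2 : S → A1 → A2 → ℝ
  /-- transition probabilities: `p s a b s'` is the probability of moving to `s'` -/
  p : S → A1 → A2 → S → ℝ
  /-- discount factor -/
  γ : ℝ
  zerosum : ∀ s a b, r1 s a b + r2 s a b = 0
  p_nonneg : ∀ s a b s', 0 ≤ p s a b s'
  p_sum_one : ∀ s a b, ∑ s', p s a b s' = 1
  γ_nonneg : 0 ≤ γ
  γ_lt_one : γ < 1
  /-- the realized state sequence -/
  st : ℕ → S
  /-- step sizes for beliefs on strategies -/
  α : ℕ → ℝ
  /-- step sizes for beliefs on Q-functions -/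
  β : ℕ → ℝ
  α_mem : ∀ c, α c ∈ Set.Ioc (0:ℝ) 1
  β_mem : ∀ c, β c ∈ Set.Ioc (0:ℝ) 1
  /-- belief (held by player 2) on player 1's mixed action at each state -/
  π1 : S → ℕ → A1 → ℝ
  /-- belief (held by player 1) on player 2's mixed action at each state -/
  π2 : S → ℕ → A2 → ℝ
  /-- player 1's belief on its own Q-function -/
  Q1 : S → ℕ → A1 → A2 → ℝ
  /-- player 2's belief on its own Q-function -/
  Q2 : S → ℕ → A1 → A2 → ℝ
  /-- best-response action of player 1 at stage k -/
  astar1 : ℕ → A1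
  /-- best-response action of player 2 at stage k -/
  astar2 : ℕ → A2
  π1_simplex : ∀ s k, π1 s k ∈ stdSimplex ℝ A1
  π2_simplex : ∀ s k, π2 s k ∈ stdSimplex ℝ A2
  Q1_init : ∀ s, Q1 s 0 = r1 s
  Q2_init : ∀ s, Q2 s 0 = r2 s
  astar1_br : ∀ k b,
    ∑ b2, Q1 (st k) k b b2 * π2 (st k) k b2
      ≤ ∑ b2, Q1 (st k) k (astar1 k) b2 * π2 (st k) k b2
  astar2_br : ∀ k b,
    ∑ b1, π1 (st k) k b1 * Q2 (st k) k b1 b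
      ≤ ∑ b1, π1 (st k) k b1 * Q2 (st k) k b1 (astar2 k)
  π1_upd : ∀ s k, π1 s (k+1) = fun b =>
    π1 s k b + (if s = st k then α (((Finset.range k).filter fun k' => st k' = s).card) else 0)
      * ((if b = astar1 k then (1:ℝ) else 0) - π1 s k b)
  π2_upd : ∀ s k, π2 s (k+1) = fun b =>
    π2 s k b + (if s = st k then α (((Finset.range k).filter fun k' => st k' = s).card) else 0)
      * ((if b = astar2 k then (1:ℝ) else 0) - π2 s k b)
  Q1_upd : ∀ s k, Q1 s (k+1) = fun b1 b2 =>
    Q1 s k b1 b2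
      + (if s = st k then β (((Finset.range k).filter fun k' => st k' = s).card) else 0)
        * (r1 s b1 b2
          + γ * ∑ s', (Finset.univ.sup' Finset.univ_nonempty fun c1 =>
              ∑ b2', Q1 s' k c1 b2' * π2 s' k b2') * p s b1 b2 s'
          - Q1 s k b1 b2)
  Q2_upd : ∀ s k, Q2 s (k+1) = fun b1 b2 =>
    Q2 s k b1 b2
      + (if s = st k then β (((Finset.range k).filter fun k' => st k' = s).card) else 0)
        * (r2 s b1 b2
          + γ * ∑ s', (Finset.univ.sup' Finset.univ_nonempty fun c2 =>
              ∑ b1', π1 s' k b1' * Q2 s' k b1' c2) * p s b1 b2 s'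
          - Q2 s k b1 b2)

variable {S A1 A2 : Type} [Fintype S] [Fintype A1] [Fintype A2]
    [Nonempty S] [Nonempty A1] [Nonempty A2]
    [DecidableEq S] [DecidableEq A1] [DecidableEq A2]

/-- the largest absolute value of an entry of a matrix -/
noncomputable def maxNorm (Q : A1 → A2 → ℝ) : ℝ :=
  Finset.univ.sup' Finset.univ_nonempty fun q : A1 × A2 => |Q q.1 q.2|

namespace MBFP

/-- the number of visits to state `s` before stage `k` -/
def cnt (G : MBFP S A1 A2) (s : S) (k : ℕ) : ℕ :=
  ((Finset.range k).filter fun k' => G.st k' = s).card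

/-- player 1's estimate of its continuation payoff at state `s` -/
noncomputable def vhat1 (G : MBFP S A1 A2) (k : ℕ) (s : S) : ℝ :=
  Finset.univ.sup' Finset.univ_nonempty fun b1 => ∑ b2, G.Q1 s k b1 b2 * G.π2 s k b2

/-- player 2's estimate of its continuation payoff at state `s` -/
noncomputable def vhat2 (G : MBFP S A1 A2) (k : ℕ) (s : S) : ℝ :=
  Finset.univ.sup' Finset.univ_nonempty fun b2 => ∑ b1, G.π1 s k b1 * G.Q2 s k b1 b2

/-- Assumption 1 of the paper -/
def Assumption1 (G : MBFP S A1 A2) : Prop :=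
  (∀ s, Tendsto (fun k => G.cnt s k) atTop atTop) ∧
  Tendsto (fun n => ∑ c ∈ Finset.range n, G.α c) atTop atTop ∧
  Tendsto (fun n => ∑ c ∈ Finset.range n, G.β c) atTop atTop ∧
  Tendsto G.α atTop (𝓝 0) ∧
  Tendsto G.β atTop (𝓝 0) ∧
  Tendsto (fun c => G.β c / G.α c) atTop (𝓝 0)

end MBFP

/-- the minimax value `val₁(Q) = min_{π2 ∈ Δ(A2)} max_{a1 ∈ A1} a1ᵀ Q π2` -/
noncomputable def val1 (Q : A1 → A2 → ℝ) : ℝ :=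
  sInf ((fun q2 : A2 → ℝ =>
    Finset.univ.sup' Finset.univ_nonempty fun b1 => ∑ b2, Q b1 b2 * q2 b2) '' stdSimplex ℝ A2)

/-- the minimax value `val₂(Q) = min_{π1 ∈ Δ(A1)} max_{a2 ∈ A2} π1ᵀ Q a2` -/
noncomputable def val2 (Q : A1 → A2 → ℝ) : ℝ :=
  sInf ((fun q1 : A1 → ℝ =>
    Finset.univ.sup' Finset.univ_nonempty fun b2 => ∑ b1, q1 b1 * Q b1 b2) '' stdSimplex ℝ A1)

namespace FictitiousPlay

open MeasureTheory
open scoped NNReal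

/-! ### Differential inequalities for Lipschitz functions -/

/-- A Lipschitz function on the whole line which is bounded above and satisfies `E' ≤ -E` almost
everywhere is nonpositive (at the origin). -/
lemma nonpos_of_ae_deriv_le_neg {E : ℝ → ℝ} {K : ℝ≥0} {C : ℝ} (hK : LipschitzWith K E)
    (hC : ∀ t, E t ≤ C) (hd : ∀ᵐ t, deriv E t ≤ -E t) : E 0 ≤ 0 := by
  have key : ∀ T : ℝ, 0 ≤ T → E 0 ≤ Real.exp (-T) * C := by
    intro T hT
    have hac : AbsolutelyContinuousOnInterval (fun t => Real.exp t * E t) (-T) 0 :=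
      (Real.contDiff_exp.contDiffOn.absolutelyContinuousOnInterval).mul
        hK.lipschitzOnWith.absolutelyContinuousOnInterval
    have hle : ∫ t in (-T)..0, deriv (fun t => Real.exp t * E t) t ≤ 0 := by
      rw [← neg_nonneg, ← intervalIntegral.integral_neg]
      apply intervalIntegral.integral_nonneg_of_ae (by linarith)
      filter_upwards [hd, hK.ae_differentiableAt_real] with t ht hdt
      have := ((Real.hasDerivAt_exp t).mul hdt.hasDerivAt).deriv
      simp only [Pi.zero_apply]
      rw [show (fun t => Real.exp t * E t) = (Real.exp * E) from rfl, this]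
      nlinarith [Real.exp_pos t]
    rw [hac.integral_deriv_eq_sub] at hle
    have := mul_le_mul_of_nonneg_left (hC (-T)) (Real.exp_pos (-T)).le
    simp only [Real.exp_zero, one_mul] at hle
    linarith
  have hlim : Tendsto (fun T : ℝ => Real.exp (-T) * C) atTop (𝓝 0) := by
    simpa using (Real.tendsto_exp_neg_atTop_nhds_zero.mul_const C)
  exact ge_of_tendsto hlim (eventually_atTop.2 ⟨0, key⟩)

lemma deriv_le_of_forall_right_le {Z : ℝ → ℝ} {s c L δ : ℝ} (hδ : 0 < δ)
    (hd : DifferentiableAt ℝ Z s)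
    (h : ∀ u, 0 < u → u ≤ δ → Z (s + u) - Z s ≤ u * c + L * u ^ 2) : deriv Z s ≤ c := by
  have h1 := hd.hasDerivAt.tendsto_slope_zero_right
  have h2 : Tendsto (fun u : ℝ => c + L * u) (𝓝[>] 0) (𝓝 c) := by
    have : Tendsto (fun u : ℝ => c + L * u) (𝓝 0) (𝓝 (c + L * 0)) := by
      apply Continuous.tendsto; fun_prop
    simpa using this.mono_left nhdsWithin_le_nhds
  refine le_of_tendsto_of_tendsto h1 h2 ?_
  filter_upwards [Ioc_mem_nhdsGT hδ] with u hu
  have := h u hu.1 hu.2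
  rw [smul_eq_mul, inv_mul_le_iff₀ hu.1]
  nlinarith

/-! ### Best-response values -/

lemma abs_le_maxNorm {A B : Type} [Fintype A] [Fintype B] [Nonempty A] [Nonempty B]
    (Q : A → B → ℝ) (a : A) (b : B) : |Q a b| ≤ maxNorm Q :=
  Finset.le_sup' (fun x : A × B => |Q x.1 x.2|) (Finset.mem_univ (a, b))

lemma maxNorm_le {A B : Type} [Fintype A] [Fintype B] [Nonempty A] [Nonempty B]
    {Q : A → B → ℝ} {C : ℝ} (h : ∀ a b, |Q a b| ≤ C) : maxNorm Q ≤ C :=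
  Finset.sup'_le _ _ fun x _ => h x.1 x.2

lemma continuous_maxNorm {A B : Type} [Fintype A] [Fintype B] [Nonempty A] [Nonempty B] :
    Continuous fun Q : A → B → ℝ => maxNorm Q := by
  unfold maxNorm
  exact Continuous.finset_sup'_apply _ fun x _ => by fun_prop

/-- The best-response value `max_a (Q q)_a` against the mixed action `q`. -/
noncomputable def bestValue {A B : Type} [Fintype A] [Fintype B] [Nonempty A]
    (Q : A → B → ℝ) (q : B → ℝ) : ℝ :=
  Finset.univ.sup' Finset.univ_nonempty fun a => ∑ b, Q a b * q b

section BestValue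

variable {A B : Type} [Fintype A] [Fintype B] [Nonempty A]

lemma le_bestValue (Q : A → B → ℝ) (q : B → ℝ) (a : A) : ∑ b, Q a b * q b ≤ bestValue Q q :=
  Finset.le_sup' (fun a => ∑ b, Q a b * q b) (Finset.mem_univ a)

lemma exists_bestValue_eq (Q : A → B → ℝ) (q : B → ℝ) : ∃ a, bestValue Q q = ∑ b, Q a b * q b := by
  obtain ⟨a, -, ha⟩ := Finset.exists_mem_eq_sup' (Finset.univ_nonempty (α := A))
    fun a => ∑ b, Q a b * q b
  exact ⟨a, ha⟩

lemma sum_mul_le_bestValue (Q : A → B → ℝ) (q : B → ℝ) {p : A → ℝ} (hp : p ∈ stdSimplex ℝ A) :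
    ∑ a, p a * ∑ b, Q a b * q b ≤ bestValue Q q := by
  calc ∑ a, p a * ∑ b, Q a b * q b ≤ ∑ a, p a * bestValue Q q :=
        Finset.sum_le_sum fun a _ => mul_le_mul_of_nonneg_left (le_bestValue Q q a) (hp.1 a)
    _ = bestValue Q q := by rw [← Finset.sum_mul, hp.2, one_mul]

lemma abs_sum_mul_le_of_mem_stdSimplex {x : B → ℝ} {q : B → ℝ} {C : ℝ} (hx : ∀ b, |x b| ≤ C)
    (hq : q ∈ stdSimplex ℝ B) : |∑ b, x b * q b| ≤ C := by
  calc |∑ b, x b * q b| ≤ ∑ b, |x b * q b| := Finset.abs_sum_le_sum_abs _ _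
    _ ≤ ∑ b, C * q b := Finset.sum_le_sum fun b _ => by
        rw [abs_mul, abs_of_nonneg (hq.1 b)]
        exact mul_le_mul_of_nonneg_right (hx b) (hq.1 b)
    _ = C := by rw [← Finset.mul_sum, hq.2, mul_one]

lemma abs_bestValue_le {Q : A → B → ℝ} {q : B → ℝ} {C : ℝ} (hQ : ∀ a b, |Q a b| ≤ C)
    (hq : q ∈ stdSimplex ℝ B) : |bestValue Q q| ≤ C := by
  obtain ⟨a, ha⟩ := exists_bestValue_eq Q q
  rw [ha]
  exact abs_sum_mul_le_of_mem_stdSimplex (hQ a) hq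

lemma continuous_bestValue :
    Continuous fun x : (A → B → ℝ) × (B → ℝ) => bestValue x.1 x.2 := by
  unfold bestValue
  exact Continuous.finset_sup'_apply _ fun a _ => by fun_prop

lemma exists_lipschitzWith_bestValue (Q : A → B → ℝ) {q : B → ℝ → ℝ} {K : B → ℝ≥0}
    (hq : ∀ b, LipschitzWith (K b) (q b)) :
    ∃ K', LipschitzWith K' fun t => bestValue Q fun b => q b t := by
  have hx : ∀ a t t', |∑ b, Q a b * q b t - ∑ b, Q a b * q b t'| ≤
      (∑ a, ∑ b, |Q a b| * K b) * |t - t'| := by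
    intro a t t'
    have h1 : ∑ b, |Q a b| * K b ≤ ∑ a, ∑ b, |Q a b| * K b :=
      Finset.single_le_sum (f := fun a => ∑ b, |Q a b| * (K b : ℝ))
        (fun a _ => Finset.sum_nonneg fun b _ => by positivity) (Finset.mem_univ a)
    refine le_trans ?_ (mul_le_mul_of_nonneg_right h1 (abs_nonneg _))
    rw [← Finset.sum_sub_distrib, Finset.sum_mul]
    refine (Finset.abs_sum_le_sum_abs _ _).trans (Finset.sum_le_sum fun b _ => ?_)
    rw [← mul_sub, abs_mul, mul_assoc]
    exact mul_le_mul_of_nonneg_left ((hq b).dist_le_mul t t') (abs_nonneg _)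
  refine ⟨NNReal.mk (∑ a, ∑ b, |Q a b| * K b) (by positivity),
    LipschitzWith.of_dist_le_mul fun t t' => ?_⟩
  rw [Real.dist_eq, Real.dist_eq, NNReal.coe_mk]
  obtain ⟨a, ha⟩ := exists_bestValue_eq Q fun b => q b t
  obtain ⟨a', ha'⟩ := exists_bestValue_eq Q fun b => q b t'
  have h1 := le_bestValue Q (fun b => q b t) a'
  have h2 := le_bestValue Q (fun b => q b t') a
  have h3 := abs_le.1 (hx a t t')
  have h4 := abs_le.1 (hx a' t t')
  rw [abs_le]
  constructor <;> linarith

omit [Nonempty A] in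
lemma sum_deriv_add_eq_one {p : A → ℝ → ℝ} {t : ℝ} (hp : ∀ a, DifferentiableAt ℝ (p a) t)
    (hsum : ∀ t, ∑ a, p a t = 1) : ∑ a, (deriv (p a) t + p a t) = 1 := by
  have h0 : HasDerivAt (fun t => ∑ a, p a t) (∑ a, deriv (p a) t) t :=
    HasDerivAt.fun_sum fun a _ => (hp a).hasDerivAt
  rw [funext hsum] at h0
  rw [Finset.sum_add_distrib, hsum t, h0.unique (hasDerivAt_const t 1), zero_add]

omit [Nonempty A] in
lemma abs_bilinear_add_le {Q₁ : A → B → ℝ} {Q₂ : B → A → ℝ} {p : A → ℝ} {q : B → ℝ} {M : ℝ}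
    (hM : ∀ a b, |Q₁ a b + Q₂ b a| ≤ M) (hp : p ∈ stdSimplex ℝ A) (hq : q ∈ stdSimplex ℝ B) :
    |∑ a, p a * ∑ b, Q₁ a b * q b + ∑ b, q b * ∑ a, Q₂ b a * p a| ≤ M := by
  have h : ∑ a, p a * ∑ b, Q₁ a b * q b + ∑ b, q b * ∑ a, Q₂ b a * p a =
      ∑ a, (∑ b, (Q₁ a b + Q₂ b a) * q b) * p a := by
    simp only [Finset.mul_sum, Finset.sum_mul]
    rw [Finset.sum_comm (f := fun b a => q b * (Q₂ b a * p a)), ← Finset.sum_add_distrib]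
    refine Finset.sum_congr rfl fun a _ => ?_
    rw [← Finset.sum_add_distrib]
    exact Finset.sum_congr rfl fun b _ => by ring
  rw [h]
  exact abs_sum_mul_le_of_mem_stdSimplex (fun a => abs_sum_mul_le_of_mem_stdSimplex
    (hM a) hq) hp

lemma neg_le_bestValue_add [Nonempty B] {Q₁ : A → B → ℝ} {Q₂ : B → A → ℝ} {p : A → ℝ} {q : B → ℝ}
    {M : ℝ} (hM : ∀ a b, |Q₁ a b + Q₂ b a| ≤ M) (hp : p ∈ stdSimplex ℝ A)
    (hq : q ∈ stdSimplex ℝ B) : -M ≤ bestValue Q₁ q + bestValue Q₂ p := by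
  have h1 := sum_mul_le_bestValue Q₁ q hp
  have h2 := sum_mul_le_bestValue Q₂ p hq
  have h3 := (abs_le.1 (abs_bilinear_add_le hM hp hq)).1
  linarith

/-- The minimax value `min_q max_a (Q q)_a`. -/
noncomputable def minimaxValue (Q : A → B → ℝ) : ℝ := sInf (bestValue Q '' stdSimplex ℝ B)

lemma minimaxValue_le_bestValue [Nonempty B] (Q : A → B → ℝ) {q : B → ℝ}
    (hq : q ∈ stdSimplex ℝ B) : minimaxValue Q ≤ bestValue Q q := by
  refine csInf_le ⟨-maxNorm Q, ?_⟩ (Set.mem_image_of_mem _ hq)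
  rintro _ ⟨q', hq', rfl⟩
  exact (abs_le.1 (abs_bestValue_le (abs_le_maxNorm Q) hq')).1

lemma bestValue_sub_minimaxValue_le [Nonempty B] {Q₁ : A → B → ℝ} {Q₂ : B → A → ℝ} {p : A → ℝ}
    {q : B → ℝ} {M : ℝ} (hM : ∀ a b, |Q₁ a b + Q₂ b a| ≤ M) (hp : p ∈ stdSimplex ℝ A)
    (hq : q ∈ stdSimplex ℝ B) :
    bestValue Q₁ q - minimaxValue Q₁ ≤ bestValue Q₁ q + bestValue Q₂ p + M := by
  have : -M - bestValue Q₂ p ≤ minimaxValue Q₁ := by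
    refine le_csInf ⟨_, Set.mem_image_of_mem _ hq⟩ ?_
    rintro _ ⟨q', hq', rfl⟩
    linarith [neg_le_bestValue_add hM hp hq']
  linarith

/-- Along a curve on which only best responses are reinforced, the best-response value decays
towards the payoff of the reinforced mixed actions. -/
lemma deriv_bestValue_eq {Q : A → B → ℝ} {p : A → ℝ → ℝ} {q : B → ℝ → ℝ} {t : ℝ}
    (hp : ∀ a, DifferentiableAt ℝ (p a) t) (hq : ∀ b, DifferentiableAt ℝ (q b) t)
    (hf : DifferentiableAt ℝ (fun t => bestValue Q fun b => q b t) t)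
    (hsum : ∀ t, ∑ a, p a t = 1)
    (hbr : ∀ a a', ∑ b, Q a b * q b t < ∑ b, Q a' b * q b t → deriv (p a) t = -p a t) :
    deriv (fun t => bestValue Q fun b => q b t) t =
      ∑ a, (deriv (p a) t + p a t) * ∑ b, Q a b * (deriv (q b) t + q b t)
        - bestValue Q fun b => q b t := by
  set f : ℝ → ℝ := fun t => bestValue Q fun b => q b t with hfdef
  have hx : ∀ a, HasDerivAt (fun t => ∑ b, Q a b * q b t) (∑ b, Q a b * deriv (q b) t) t :=
    fun a => HasDerivAt.fun_sum fun b _ => (hq b).hasDerivAt.const_mul _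
  have hactive : ∀ a, ∑ b, Q a b * q b t = f t → deriv f t = ∑ b, Q a b * deriv (q b) t := by
    intro a ha
    have hmin : IsLocalMin (fun s => f s - ∑ b, Q a b * q b s) t := by
      refine Filter.Eventually.of_forall fun s => ?_
      simp only [ha, sub_self, sub_nonneg]
      exact le_bestValue Q (fun b => q b s) a
    have := hmin.hasDerivAt_eq_zero (hf.hasDerivAt.sub (hx a))
    linarith
  have hterm : ∀ a, (deriv (p a) t + p a t) * ∑ b, Q a b * (deriv (q b) t + q b t)
      = (deriv (p a) t + p a t) * (deriv f t + f t) := by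
    intro a
    rcases (le_bestValue Q (fun b => q b t) a).lt_or_eq with hlt | heq
    · obtain ⟨a', ha'⟩ := exists_bestValue_eq Q fun b => q b t
      rw [hbr a a' (ha' ▸ hlt)]
      ring
    · rw [hactive a heq, ← show _ = f t from heq]
      simp only [mul_add, Finset.sum_add_distrib]
  rw [Finset.sum_congr rfl fun a _ => hterm a, ← Finset.sum_mul, sum_deriv_add_eq_one hp hsum]
  ring

end BestValue

/-! ### The continuous-time limit of a sequence with vanishing step sizes -/

/-- Elapsed time after `k` steps of sizes `α 0, α 1, …`. -/
noncomputable def elapsed (α : ℕ → ℝ) (k : ℕ) : ℝ := ∑ c ∈ Finset.range k, α c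

section Clock

variable {α : ℕ → ℝ}

lemma elapsed_succ (α : ℕ → ℝ) (k : ℕ) : elapsed α (k + 1) = elapsed α k + α k :=
  Finset.sum_range_succ _ _

lemma elapsed_mono (hα : ∀ k, 0 ≤ α k) : Monotone (elapsed α) :=
  monotone_nat_of_le_succ fun k => by rw [elapsed_succ]; linarith [hα k]

lemma abs_sub_le_elapsed_aux {z : ℕ → ℝ} {L : ℝ} {K : ℕ}
    (hz : ∀ k, K ≤ k → |z (k + 1) - z k| ≤ L * α k) {m l : ℕ} (hm : K ≤ m) (hml : m ≤ l) :
    |z l - z m| ≤ L * (elapsed α l - elapsed α m) := by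
  induction l, hml using Nat.le_induction with
  | base => simp
  | succ l hml ih =>
    have h1 := hz l (hm.trans hml)
    have h2 := abs_sub_le (z (l + 1)) (z l) (z m)
    rw [elapsed_succ]
    linarith

lemma abs_sub_le_elapsed (hα : ∀ k, 0 ≤ α k) {z : ℕ → ℝ} {L : ℝ} {K : ℕ}
    (hz : ∀ k, K ≤ k → |z (k + 1) - z k| ≤ L * α k) {m l : ℕ} (hm : K ≤ m) (hl : K ≤ l) :
    |z l - z m| ≤ L * |elapsed α l - elapsed α m| := by
  rcases le_total m l with h | h
  · rw [abs_of_nonneg (sub_nonneg.2 (elapsed_mono hα h))]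
    exact abs_sub_le_elapsed_aux hz hm h
  · rw [abs_sub_comm, abs_sub_comm (elapsed α l), abs_of_nonneg (sub_nonneg.2 (elapsed_mono hα h))]
    exact abs_sub_le_elapsed_aux hz hl h

/-- A sequence whose increments are bounded by a multiple of the step sizes. -/
def LipschitzInTime (α : ℕ → ℝ) (z : ℕ → ℝ) : Prop :=
  ∃ L, 0 ≤ L ∧ ∀ k, |z (k + 1) - z k| ≤ L * α k

namespace LipschitzInTime

lemma abs_sub_le (hα : ∀ k, 0 ≤ α k) {z : ℕ → ℝ} (hz : LipschitzInTime α z) :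
    ∃ L, 0 ≤ L ∧ ∀ m l, |z l - z m| ≤ L * |elapsed α l - elapsed α m| := by
  obtain ⟨L, hL, h⟩ := hz
  exact ⟨L, hL, fun m l => abs_sub_le_elapsed hα (fun k _ => h k) (Nat.zero_le m) (Nat.zero_le l)⟩

lemma sub {y z : ℕ → ℝ} (hy : LipschitzInTime α y) (hz : LipschitzInTime α z) :
    LipschitzInTime α fun k => y k - z k := by
  obtain ⟨L, hL, hy⟩ := hy
  obtain ⟨M, hM, hz⟩ := hz
  refine ⟨L + M, by positivity, fun k => ?_⟩
  have h1 := abs_le.1 (hy k)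
  have h2 := abs_le.1 (hz k)
  rw [abs_le]
  constructor <;> linarith

lemma neg {z : ℕ → ℝ} (hz : LipschitzInTime α z) : LipschitzInTime α fun k => -z k := by
  obtain ⟨L, hL, hz⟩ := hz
  refine ⟨L, hL, fun k => ?_⟩
  rw [← abs_neg, show -(-z (k + 1) - -z k) = z (k + 1) - z k by ring]
  exact hz k

lemma mul {y z : ℕ → ℝ} {C D : ℝ} (hy : LipschitzInTime α y) (hz : LipschitzInTime α z)
    (hyC : ∀ k, |y k| ≤ C) (hzD : ∀ k, |z k| ≤ D) : LipschitzInTime α fun k => y k * z k := by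
  obtain ⟨L, hL, hy⟩ := hy
  obtain ⟨M, hM, hz⟩ := hz
  have hC : 0 ≤ C := (abs_nonneg _).trans (hyC 0)
  have hD : 0 ≤ D := (abs_nonneg _).trans (hzD 0)
  refine ⟨C * M + L * D, by positivity, fun k => ?_⟩
  calc |y (k + 1) * z (k + 1) - y k * z k|
      = |y (k + 1) * (z (k + 1) - z k) + (y (k + 1) - y k) * z k| := by ring_nf
    _ ≤ |y (k + 1)| * |z (k + 1) - z k| + |y (k + 1) - y k| * |z k| := by
        rw [← abs_mul, ← abs_mul]; exact abs_add_le _ _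
    _ ≤ C * (M * α k) + L * α k * D :=
        add_le_add (mul_le_mul (hyC _) (hz k) (abs_nonneg _) hC)
          (mul_le_mul (hy k) (hzD k) (abs_nonneg _) ((abs_nonneg _).trans (hy k)))
    _ = (C * M + L * D) * α k := by ring

lemma sum {ι : Type} [Fintype ι] {z : ι → ℕ → ℝ} (hz : ∀ i, LipschitzInTime α (z i)) :
    LipschitzInTime α fun k => ∑ i, z i k := by
  choose L hL hz using hz
  refine ⟨∑ i, L i, Finset.sum_nonneg fun i _ => hL i, fun k => ?_⟩
  rw [← Finset.sum_sub_distrib, Finset.sum_mul]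
  exact (Finset.abs_sum_le_sum_abs _ _).trans (Finset.sum_le_sum fun i _ => hz i k)

end LipschitzInTime

/-- `idx n s` is a stage whose elapsed time is `s` after (or `-s` before) that of stage `n`,
asymptotically along the filter `U`. -/
structure IsClock (α : ℕ → ℝ) (U : Filter ℕ) (idx : ℕ → ℝ → ℕ) : Prop where
  mono : ∀ n, Monotone (idx n)
  tendsto_atTop : ∀ s, Tendsto (fun n => idx n s) U atTop
  tendsto_elapsed : ∀ s, Tendsto (fun n => elapsed α (idx n s) - elapsed α n) U (𝓝 s)

lemma exists_isClock (hα : ∀ k, 0 ≤ α k) (hsum : Tendsto (elapsed α) atTop atTop)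
    (h0 : Tendsto α atTop (𝓝 0)) : ∃ idx, IsClock α atTop idx := by
  classical
  have hex : ∀ (n : ℕ) (s : ℝ), ∃ k, elapsed α n + s ≤ elapsed α k := fun n s =>
    (hsum.eventually_ge_atTop (elapsed α n + s)).exists
  have hinf : ∀ s, Tendsto (fun n => Nat.find (hex n s)) atTop atTop := by
    intro s
    refine tendsto_atTop.2 fun K => ?_
    filter_upwards [hsum.eventually_gt_atTop (elapsed α K - s)] with n hn
    by_contra! hlt
    have h1 := Nat.find_spec (hex n s)
    have h2 := elapsed_mono hα hlt.le
    linarith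
  refine ⟨fun n s => Nat.find (hex n s), fun n s s' hs => ?_, hinf, fun s => ?_⟩
  · exact Nat.find_min' _ ((by linarith : elapsed α n + s ≤ elapsed α n + s').trans
      (Nat.find_spec (hex n s')))
  · have hpred : Tendsto (fun n => s + α (Nat.find (hex n s) - 1)) atTop (𝓝 (s + 0)) :=
      tendsto_const_nhds.add (h0.comp ((tendsto_sub_atTop_nat 1).comp (hinf s)))
    rw [add_zero] at hpred
    refine tendsto_of_tendsto_of_tendsto_of_le_of_le' tendsto_const_nhds hpred
      (Eventually.of_forall fun n => ?_) ?_
    · have := Nat.find_spec (hex n s)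
      linarith
    · filter_upwards [(hinf s).eventually_ge_atTop 1] with n hn
      have h1 := Nat.find_min (hex n s) (show Nat.find (hex n s) - 1 < Nat.find (hex n s) by omega)
      have h2 := elapsed_succ α (Nat.find (hex n s) - 1)
      rw [Nat.sub_add_cancel hn] at h2
      linarith

namespace IsClock

variable {U : Filter ℕ} {idx : ℕ → ℝ → ℕ}

lemma mono_filter {V : Filter ℕ} (hc : IsClock α V idx) (h : U ≤ V) : IsClock α U idx :=
  ⟨hc.mono, fun s => (hc.tendsto_atTop s).mono_left h, fun s => (hc.tendsto_elapsed s).mono_left h⟩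

lemma tendsto_elapsed_sub (hc : IsClock α U idx) (s s' : ℝ) :
    Tendsto (fun n => elapsed α (idx n s') - elapsed α (idx n s)) U (𝓝 (s' - s)) := by
  simpa using (hc.tendsto_elapsed s').sub (hc.tendsto_elapsed s)

/-- A sequence moving at vanishing speed has a constant limit. -/
lemma tendsto_sub_zero (hc : IsClock α U idx) (hα : ∀ k, 0 ≤ α k) (hU : U ≤ atTop)
    {z ε : ℕ → ℝ} (hε : Tendsto ε atTop (𝓝 0)) (hz : ∀ k, |z (k + 1) - z k| ≤ ε k * α k)
    (s : ℝ) : Tendsto (fun n => z (idx n s) - z n) U (𝓝 0) := by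
  rw [Metric.tendsto_nhds]
  intro η hη
  have hη' : 0 < η / (|s| + 1) := by positivity
  obtain ⟨K, hK⟩ := eventually_atTop.1 (hε.eventually_le_const hη')
  filter_upwards [(hc.tendsto_atTop s).eventually_ge_atTop K, hU (eventually_ge_atTop K),
    (hc.tendsto_elapsed s).abs.eventually_lt_const (lt_add_one |s|)] with n h1 h2 h3
  rw [Real.dist_eq, sub_zero]
  calc |z (idx n s) - z n| ≤ η / (|s| + 1) * |elapsed α (idx n s) - elapsed α n| :=
        abs_sub_le_elapsed hα
          (fun k hk => (hz k).trans (mul_le_mul_of_nonneg_right (hK k hk) (hα k))) h2 h1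
    _ < η / (|s| + 1) * (|s| + 1) := mul_lt_mul_of_pos_left h3 hη'
    _ = η := by field_simp

lemma tendsto_self (hc : IsClock α U idx) (hα : ∀ k, 0 ≤ α k) {z : ℕ → ℝ}
    (hz : LipschitzInTime α z) : Tendsto (fun n => z (idx n 0) - z n) U (𝓝 0) := by
  obtain ⟨L, -, hL⟩ := hz.abs_sub_le hα
  refine squeeze_zero_norm (fun n => hL n (idx n 0)) ?_
  simpa using (hc.tendsto_elapsed 0).abs.const_mul L

lemma lipschitzWith_limit [U.NeBot] (hc : IsClock α U idx) (hα : ∀ k, 0 ≤ α k) {z : ℕ → ℝ}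
    {Z : ℝ → ℝ} (hz : LipschitzInTime α z)
    (hZ : ∀ s, Tendsto (fun n => z (idx n s)) U (𝓝 (Z s))) : ∃ K : ℝ≥0, LipschitzWith K Z := by
  obtain ⟨L, hL0, hL⟩ := hz.abs_sub_le hα
  refine ⟨NNReal.mk L hL0, LipschitzWith.of_dist_le_mul fun s s' => ?_⟩
  rw [Real.dist_eq, Real.dist_eq]
  exact le_of_tendsto_of_tendsto' ((hZ s).sub (hZ s')).abs
    ((hc.tendsto_elapsed_sub s' s).abs.const_mul L) fun n => hL _ _

lemma exists_pos_window (hc : IsClock α U idx) (hα : ∀ k, 0 ≤ α k) {z : ℕ → ℝ} {s ζ : ℝ}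
    (hz : LipschitzInTime α z) (hZ : Tendsto (fun n => z (idx n s)) U (𝓝 ζ)) (hζ : 0 < ζ) :
    ∃ δ > 0, ∀ᶠ n in U, ∀ k, idx n s ≤ k → k < idx n (s + δ) → 0 < z k := by
  obtain ⟨L, hL0, hL⟩ := hz.abs_sub_le hα
  have hδ : 0 < ζ / (4 * (L + 1)) := by positivity
  refine ⟨_, hδ, ?_⟩
  have hlim := hc.tendsto_elapsed_sub s (s + ζ / (4 * (L + 1)))
  rw [add_sub_cancel_left] at hlim
  filter_upwards [hlim.eventually_lt_const (u := 2 * (ζ / (4 * (L + 1)))) (by linarith),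
    hZ.eventually_const_lt (u := ζ / 2) (by linarith)] with n h1 h2 k hk1 hk2
  have h3 := hL (idx n s) k
  rw [abs_of_nonneg (sub_nonneg.2 (elapsed_mono hα hk1))] at h3
  have h4 := elapsed_mono hα hk2.le
  have h5 : L * (elapsed α k - elapsed α (idx n s)) ≤ L * (2 * (ζ / (4 * (L + 1)))) :=
    mul_le_mul_of_nonneg_left (by linarith) hL0
  have h6 : L * (2 * (ζ / (4 * (L + 1)))) ≤ ζ / 2 := by
    rw [show L * (2 * (ζ / (4 * (L + 1)))) = (ζ / 2) * (L / (L + 1)) by field_simp; norm_num]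
    exact mul_le_of_le_one_right (by linarith) ((div_le_one (by linarith)).2 (by linarith))
  linarith [(abs_le.1 h3).1]

end IsClock

lemma sub_le_of_forall_step_le (hα : ∀ k, 0 ≤ α k) {z : ℕ → ℝ} {L : ℝ} (hL : 0 ≤ L)
    (hz : ∀ k, |z (k + 1) - z k| ≤ L * α k) {m l : ℕ} (hml : m ≤ l)
    (hstep : ∀ k, m ≤ k → k < l → z (k + 1) - z k ≤ -(α k * z k)) :
    z l - z m ≤ (elapsed α l - elapsed α m) * (-z m) + L * (elapsed α l - elapsed α m) ^ 2 := by
  induction l, hml using Nat.le_induction with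
  | base => simp
  | succ l hml ih =>
    have h1 := ih fun k hk hkl => hstep k hk (hkl.trans (Nat.lt_succ_self l))
    have h2 := hstep l hml (Nat.lt_succ_self l)
    have h3 := (abs_le.1 (abs_sub_le_elapsed_aux (K := 0) (fun k _ => hz k) (Nat.zero_le m) hml)).1
    have h4 := mul_le_mul_of_nonneg_left h3 (hα l)
    have h5 : 0 ≤ α l * (L * (elapsed α l - elapsed α m)) :=
      mul_nonneg (hα l) (mul_nonneg hL (sub_nonneg.2 (elapsed_mono hα hml)))
    have h6 : 0 ≤ L * α l ^ 2 := mul_nonneg hL (sq_nonneg _)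
    rw [elapsed_succ]
    nlinarith

lemma IsClock.deriv_limit_le_neg {U : Filter ℕ} [U.NeBot] {idx : ℕ → ℝ → ℕ}
    (hc : IsClock α U idx) (hα : ∀ k, 0 ≤ α k) {z : ℕ → ℝ} {Z : ℝ → ℝ} {s δ : ℝ} (hδ : 0 < δ)
    (hz : LipschitzInTime α z) (hZ : ∀ s, Tendsto (fun n => z (idx n s)) U (𝓝 (Z s)))
    (hd : DifferentiableAt ℝ Z s)
    (hstep : ∀ᶠ n in U, ∀ k, idx n s ≤ k → k < idx n (s + δ) →
      z (k + 1) - z k ≤ -(α k * z k)) : deriv Z s ≤ -Z s := by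
  obtain ⟨L, hL0, hL⟩ := hz
  refine deriv_le_of_forall_right_le (L := L) hδ hd fun u hu huδ => ?_
  have hlim := hc.tendsto_elapsed_sub s (s + u)
  rw [add_sub_cancel_left] at hlim
  refine le_of_tendsto_of_tendsto ((hZ (s + u)).sub (hZ s))
    ((hlim.mul (hZ s).neg).add ((hlim.pow 2).const_mul L)) ?_
  filter_upwards [hstep] with n hn
  exact sub_le_of_forall_step_le hα hL0 hL (hc.mono n (by linarith)) fun k hk hkl =>
    hn k hk (hkl.trans_le (hc.mono n (by linarith)))

lemma exists_ultrafilter_limit {U : Ultrafilter ℕ} {z : ℕ → ℝ} {C : ℝ} (hz : ∀ k, |z k| ≤ C) :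
    ∃ ζ, Tendsto z U (𝓝 ζ) := by
  have hmem : ∀ᶠ k in (U : Filter ℕ), z k ∈ Set.Icc (-C) C :=
    Eventually.of_forall fun k => abs_le.1 (hz k)
  obtain ⟨ζ, -, hζ⟩ := isCompact_Icc.ultrafilter_le_nhds (U.map z) (le_principal_iff.2 hmem)
  exact ⟨ζ, hζ⟩

end Clock

/-! ### Fictitious play with slowly varying payoffs -/

/-- The beliefs `p` move with step sizes `α` towards the actions `act`. -/
structure IsReinforced {A : Type} [Fintype A] [DecidableEq A] (α : ℕ → ℝ) (act : ℕ → A)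
    (p : ℕ → A → ℝ) : Prop where
  mem_stdSimplex : ∀ k, p k ∈ stdSimplex ℝ A
  update : ∀ k a, p (k + 1) a = p k a + α k * ((if a = act k then 1 else 0) - p k a)

/-- Whenever the step size is nonzero, `act` is a best response to `q` with respect to `Q`. -/
def IsBestResponse {A B : Type} [Fintype B] (α : ℕ → ℝ) (act : ℕ → A)
    (Q : ℕ → A → B → ℝ) (q : ℕ → B → ℝ) : Prop :=
  ∀ k, α k ≠ 0 → ∀ a, ∑ b, Q k a b * q k b ≤ ∑ b, Q k (act k) b * q k b

/-- The entries of `Q` are bounded and vary at a slower rate than the elapsed time. -/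
structure IsSlow {A B : Type} (α : ℕ → ℝ) (Q : ℕ → A → B → ℝ) : Prop where
  bounded : ∃ C, ∀ k a b, |Q k a b| ≤ C
  slow : ∃ ε : ℕ → ℝ, Tendsto ε atTop (𝓝 0) ∧
    ∀ k a b, |Q (k + 1) a b - Q k a b| ≤ ε k * α k

section Play

variable {α : ℕ → ℝ} {A B : Type} [Fintype A] [Fintype B] [Nonempty A] [Nonempty B]
  [DecidableEq A] [DecidableEq B]

omit [Nonempty A] in
lemma IsReinforced.abs_le_one {act : ℕ → A} {p : ℕ → A → ℝ} (h : IsReinforced α act p)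
    (k : ℕ) (a : A) : |p k a| ≤ 1 := by
  have hmem := h.mem_stdSimplex k
  rw [abs_of_nonneg (hmem.1 a), ← hmem.2]
  exact Finset.single_le_sum (fun b _ => hmem.1 b) (Finset.mem_univ a)

omit [Nonempty A] in
lemma IsReinforced.lipschitzInTime {act : ℕ → A} {p : ℕ → A → ℝ} (h : IsReinforced α act p)
    (hα : ∀ k, 0 ≤ α k) (a : A) : LipschitzInTime α fun k => p k a := by
  refine ⟨1, zero_le_one, fun k => ?_⟩
  have h1 := abs_le.1 (h.abs_le_one k a)
  have h2 := (h.mem_stdSimplex k).1 a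
  simp only [h.update, add_sub_cancel_left]
  rw [abs_mul, abs_of_nonneg (hα k), mul_comm]
  refine mul_le_mul_of_nonneg_right ?_ (hα k)
  rw [abs_le]
  split_ifs <;> constructor <;> linarith

omit [Fintype A] [Fintype B] [Nonempty A] [Nonempty B] [DecidableEq A] [DecidableEq B] in
lemma IsSlow.lipschitzInTime {Q : ℕ → A → B → ℝ} (h : IsSlow α Q) (hα : ∀ k, 0 ≤ α k)
    (a : A) (b : B) : LipschitzInTime α fun k => Q k a b := by
  obtain ⟨ε, hε, hQ⟩ := h.slow
  obtain ⟨L, hL⟩ := hε.bddAbove_range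
  exact ⟨max L 0, le_max_right _ _, fun k => (hQ k a b).trans
    (mul_le_mul_of_nonneg_right ((hL (Set.mem_range_self k)).trans (le_max_left _ _)) (hα k))⟩

omit [Nonempty A] [Nonempty B] [DecidableEq B] in
/-- In the limit, the actions which are reinforced are best responses. -/
lemma deriv_limit_belief {U : Filter ℕ} [U.NeBot] {idx : ℕ → ℝ → ℕ} (hc : IsClock α U idx)
    (hα : ∀ k, 0 ≤ α k) {act : ℕ → A} {p : ℕ → A → ℝ} {q : ℕ → B → ℝ} {Q : ℕ → A → B → ℝ}
    (hp : IsReinforced α act p) (hbr : IsBestResponse α act Q q) (hQ : IsSlow α Q)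
    (hq : ∀ b, LipschitzInTime α fun k => q k b) (hq1 : ∀ k b, |q k b| ≤ 1)
    {P : A → ℝ → ℝ} {q' : B → ℝ → ℝ} {Q' : A → B → ℝ}
    (hP : ∀ a s, Tendsto (fun n => p (idx n s) a) U (𝓝 (P a s)))
    (hq' : ∀ b s, Tendsto (fun n => q (idx n s) b) U (𝓝 (q' b s)))
    (hQ' : ∀ a b s, Tendsto (fun n => Q (idx n s) a b) U (𝓝 (Q' a b)))
    {t : ℝ} {a : A} (hd : DifferentiableAt ℝ (P a) t) :
    0 ≤ deriv (P a) t + P a t ∧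
      ∀ a', ∑ b, Q' a b * q' b t < ∑ b, Q' a' b * q' b t → deriv (P a) t = -P a t := by
  have hslow := hp.lipschitzInTime hα a
  have hlow : 0 ≤ deriv (P a) t + P a t := by
    have := hc.deriv_limit_le_neg hα one_pos hslow.neg (fun s => (hP a s).neg) hd.fun_neg
      (Eventually.of_forall fun n k _ _ => by
        rw [hp.update]
        have : 0 ≤ α k * (if a = act k then (1 : ℝ) else 0) :=
          mul_nonneg (hα k) (by split_ifs <;> norm_num)
        linarith)
    rw [deriv.fun_neg] at this
    linarith
  refine ⟨hlow, fun a' ha' => ?_⟩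
  obtain ⟨C, hC⟩ := hQ.bounded
  have hpay : ∀ a, LipschitzInTime α fun k => ∑ b, Q k a b * q k b := fun a =>
    LipschitzInTime.sum fun b =>
      (hQ.lipschitzInTime hα a b).mul (hq b) (fun k => hC k a b) (fun k => hq1 k b)
  have hlim : ∀ a, Tendsto (fun n => ∑ b, Q (idx n t) a b * q (idx n t) b) U
      (𝓝 (∑ b, Q' a b * q' b t)) := fun a =>
    tendsto_finsetSum _ fun b _ => (hQ' a b t).mul (hq' b t)
  obtain ⟨δ, hδ, hwin⟩ := hc.exists_pos_window hα ((hpay a').sub (hpay a))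
    ((hlim a').sub (hlim a)) (sub_pos.2 ha')
  have := hc.deriv_limit_le_neg hα hδ hslow (hP a) hd <| by
    filter_upwards [hwin] with n hn k hk1 hk2
    have hpos := hn k hk1 hk2
    rw [hp.update]
    rcases eq_or_ne (α k) 0 with h0 | h0
    · simp [h0]
    · have hne : a ≠ act k := by
        rintro rfl
        linarith [hbr k h0 a']
      rw [if_neg hne]
      linarith
  linarith

/-- In two-player fictitious play with slowly varying payoffs, the sum of the best-response values
is asymptotically at most the deviation of the payoffs from being zero-sum. -/
theorem eventually_bestValue_add_le (hα : ∀ k, 0 ≤ α k)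
    (hsum : Tendsto (elapsed α) atTop atTop) (h0 : Tendsto α atTop (𝓝 0))
    {act₁ : ℕ → A} {act₂ : ℕ → B} {p : ℕ → A → ℝ} {q : ℕ → B → ℝ}
    {Q₁ : ℕ → A → B → ℝ} {Q₂ : ℕ → B → A → ℝ}
    (hp : IsReinforced α act₁ p) (hq : IsReinforced α act₂ q)
    (hbr₁ : IsBestResponse α act₁ Q₁ q) (hbr₂ : IsBestResponse α act₂ Q₂ p)
    (hQ₁ : IsSlow α Q₁) (hQ₂ : IsSlow α Q₂) {η : ℝ} (hη : 0 < η) :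
    ∀ᶠ k in atTop, bestValue (Q₁ k) (q k) + bestValue (Q₂ k) (p k)
      ≤ maxNorm (fun a b => Q₁ k a b + Q₂ k b a) + η := by
  by_contra hcon
  obtain ⟨idx, hclock⟩ := exists_isClock hα hsum h0
  set V : Set ℕ := {k | ¬ bestValue (Q₁ k) (q k) + bestValue (Q₂ k) (p k) ≤
    maxNorm (fun a b => Q₁ k a b + Q₂ k b a) + η}
  have hne : (atTop ⊓ 𝓟 V).NeBot :=
    Filter.frequently_mem_iff_neBot.1 (Filter.not_eventually.1 hcon)
  set U : Ultrafilter ℕ := Ultrafilter.of (atTop ⊓ 𝓟 V)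
  have hU : (U : Filter ℕ) ≤ atTop := (Ultrafilter.of_le _).trans inf_le_left
  have hUη : ∀ᶠ k in (U : Filter ℕ), maxNorm (fun a b => Q₁ k a b + Q₂ k b a) + η ≤
      bestValue (Q₁ k) (q k) + bestValue (Q₂ k) (p k) := by
    have hV : V ∈ (U : Filter ℕ) :=
      le_principal_iff.1 ((Ultrafilter.of_le (atTop ⊓ 𝓟 V)).trans inf_le_right)
    filter_upwards [hV] with k hk using (not_le.1 hk).le
  have hc : IsClock α (U : Filter ℕ) idx := hclock.mono_filter hU
  obtain ⟨C₁, hC₁⟩ := hQ₁.bounded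
  obtain ⟨C₂, hC₂⟩ := hQ₂.bounded
  obtain ⟨ε₁, hε₁, hs₁⟩ := hQ₁.slow
  obtain ⟨ε₂, hε₂, hs₂⟩ := hQ₂.slow
  choose Q₁' hQ₁' using fun a b => exists_ultrafilter_limit (U := U) fun k => hC₁ k a b
  choose Q₂' hQ₂' using fun a b => exists_ultrafilter_limit (U := U) fun k => hC₂ k a b
  choose P hP using fun a s =>
    exists_ultrafilter_limit (U := U) fun n => hp.abs_le_one (idx n s) a
  choose R hR using fun b s =>
    exists_ultrafilter_limit (U := U) fun n => hq.abs_le_one (idx n s) b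
  have hQ₁s : ∀ a b s, Tendsto (fun n => Q₁ (idx n s) a b) U (𝓝 (Q₁' a b)) := fun a b s => by
    simpa using (hc.tendsto_sub_zero (z := fun k => Q₁ k a b) hα hU hε₁ (fun k => hs₁ k a b) s).add (hQ₁' a b)
  have hQ₂s : ∀ a b s, Tendsto (fun n => Q₂ (idx n s) a b) U (𝓝 (Q₂' a b)) := fun a b s => by
    simpa using (hc.tendsto_sub_zero (z := fun k => Q₂ k a b) hα hU hε₂ (fun k => hs₂ k a b) s).add (hQ₂' a b)
  have hPsimp : ∀ s, (fun a => P a s) ∈ stdSimplex ℝ A := fun s =>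
    (isClosed_stdSimplex ℝ A).mem_of_tendsto (tendsto_pi_nhds.2 fun a => hP a s)
      (Eventually.of_forall fun n => hp.mem_stdSimplex _)
  have hRsimp : ∀ s, (fun b => R b s) ∈ stdSimplex ℝ B := fun s =>
    (isClosed_stdSimplex ℝ B).mem_of_tendsto (tendsto_pi_nhds.2 fun b => hR b s)
      (Eventually.of_forall fun n => hq.mem_stdSimplex _)
  choose KP hKP using fun a => hc.lipschitzWith_limit hα (hp.lipschitzInTime hα a) (hP a)
  choose KR hKR using fun b => hc.lipschitzWith_limit hα (hq.lipschitzInTime hα b) (hR b)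
  obtain ⟨Kf, hKf⟩ := exists_lipschitzWith_bestValue Q₁' hKR
  obtain ⟨Kg, hKg⟩ := exists_lipschitzWith_bestValue Q₂' hKP
  set M := maxNorm fun a b => Q₁' a b + Q₂' b a with hM
  have hE : bestValue Q₁' (fun b => R b 0) + bestValue Q₂' (fun a => P a 0) - M ≤ 0 := by
    refine nonpos_of_ae_deriv_le_neg (C := C₁ + C₂ - M)
      (E := fun t => bestValue Q₁' (fun b => R b t) + bestValue Q₂' (fun a => P a t) - M)
      ((hKf.add hKg).sub (LipschitzWith.const M)) (fun t => ?_) ?_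
    · have h1 := abs_le.1 (abs_bestValue_le (fun a b => le_of_tendsto (hQ₁' a b).abs
        (Eventually.of_forall fun k => hC₁ k a b)) (hRsimp t))
      have h2 := abs_le.1 (abs_bestValue_le (fun a b => le_of_tendsto (hQ₂' a b).abs
        (Eventually.of_forall fun k => hC₂ k a b)) (hPsimp t))
      linarith
    · filter_upwards [ae_all_iff.2 fun a => (hKP a).ae_differentiableAt_real,
        ae_all_iff.2 fun b => (hKR b).ae_differentiableAt_real, hKf.ae_differentiableAt_real,
        hKg.ae_differentiableAt_real] with t hPd hRd hfd hgd
      have hA := fun a => deriv_limit_belief hc hα hp hbr₁ hQ₁ (hq.lipschitzInTime hα)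
        hq.abs_le_one hP hR hQ₁s (hPd a)
      have hB := fun b => deriv_limit_belief hc hα hq hbr₂ hQ₂ (hp.lipschitzInTime hα)
        hp.abs_le_one hR hP hQ₂s (hRd b)
      have hf := deriv_bestValue_eq hPd hRd hfd (fun s => (hPsimp s).2) fun a a' => (hA a).2 a'
      have hg := deriv_bestValue_eq hRd hPd hgd (fun s => (hRsimp s).2) fun b b' => (hB b).2 b'
      rw [deriv_sub_const, deriv_fun_add hfd hgd, hf, hg]
      have hrate₁ : (fun a => deriv (P a) t + P a t) ∈ stdSimplex ℝ A :=
        ⟨fun a => (hA a).1, sum_deriv_add_eq_one hPd fun s => (hPsimp s).2⟩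
      have hrate₂ : (fun b => deriv (R b) t + R b t) ∈ stdSimplex ℝ B :=
        ⟨fun b => (hB b).1, sum_deriv_add_eq_one hRd fun s => (hRsimp s).2⟩
      have := (abs_le.1 (abs_bilinear_add_le
        (abs_le_maxNorm fun a b => Q₁' a b + Q₂' b a) hrate₁ hrate₂)).2
      linarith
  have hRlim : ∀ b, Tendsto (fun n => q n b) U (𝓝 (R b 0)) := fun b => by
    simpa using (hR b 0).sub (hc.tendsto_self hα (hq.lipschitzInTime hα b))
  have hPlim : ∀ a, Tendsto (fun n => p n a) U (𝓝 (P a 0)) := fun a => by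
    simpa using (hP a 0).sub (hc.tendsto_self hα (hp.lipschitzInTime hα a))
  have hQ₁lim : Tendsto Q₁ U (𝓝 Q₁') :=
    tendsto_pi_nhds.2 fun a => tendsto_pi_nhds.2 fun b => hQ₁' a b
  have hQ₂lim : Tendsto Q₂ U (𝓝 Q₂') :=
    tendsto_pi_nhds.2 fun a => tendsto_pi_nhds.2 fun b => hQ₂' a b
  have hf := (continuous_bestValue.tendsto (Q₁', fun b => R b 0)).comp
    (hQ₁lim.prodMk_nhds (tendsto_pi_nhds.2 hRlim))
  have hg := (continuous_bestValue.tendsto (Q₂', fun a => P a 0)).comp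
    (hQ₂lim.prodMk_nhds (tendsto_pi_nhds.2 hPlim))
  have hQlim : Tendsto (fun k a b => Q₁ k a b + Q₂ k b a) U (𝓝 fun a b => Q₁' a b + Q₂' b a) :=
    tendsto_pi_nhds.2 fun a => tendsto_pi_nhds.2 fun b => (hQ₁' a b).add (hQ₂' b a)
  have hm := (continuous_maxNorm.tendsto fun a b => Q₁' a b + Q₂' b a).comp
    hQlim
  have := le_of_tendsto_of_tendsto (hm.add_const η) (hf.add hg) hUη
  simp only at this
  linarith

end Play

/-! ### Asynchronous averaging -/

lemma eventually_abs_le_of_averaging {b z w : ℕ → ℝ} {W η : ℝ} (hb0 : ∀ k, 0 ≤ b k)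
    (hb1 : ∀ k, b k ≤ 1) (hb : Tendsto (elapsed b) atTop atTop)
    (hz : ∀ k, z (k + 1) = z k + b k * (w k - z k)) (hw : ∀ᶠ k in atTop, |w k| ≤ W)
    (hη : 0 < η) : ∀ᶠ k in atTop, |z k| ≤ W + η := by
  obtain ⟨K, hK⟩ := eventually_atTop.1 hw
  have key : ∀ k, K ≤ k →
      |z k| - W ≤ Real.exp (-(elapsed b k - elapsed b K)) * max (|z K| - W) 0 := by
    intro k hk
    induction k, hk using Nat.le_induction with
    | base => simp
    | succ k hk ih =>
      have h1 : |z (k + 1)| ≤ (1 - b k) * |z k| + b k * W := by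
        rw [hz, show z k + b k * (w k - z k) = (1 - b k) * z k + b k * w k by ring]
        refine (abs_add_le _ _).trans ?_
        rw [abs_mul, abs_mul, abs_of_nonneg (hb0 k), abs_of_nonneg (sub_nonneg.2 (hb1 k))]
        have := mul_le_mul_of_nonneg_left (hK k hk) (hb0 k)
        linarith
      have h2 := mul_le_mul_of_nonneg_left ih (sub_nonneg.2 (hb1 k))
      have h3 : 1 - b k ≤ Real.exp (-b k) := Real.one_sub_le_exp_neg _
      rw [elapsed_succ, show -(elapsed b k + b k - elapsed b K) =
        -b k + -(elapsed b k - elapsed b K) by ring, Real.exp_add, mul_assoc]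
      have h4 := mul_le_mul_of_nonneg_right h3 (mul_nonneg
        (Real.exp_pos (-(elapsed b k - elapsed b K))).le (le_max_right (|z K| - W) 0))
      nlinarith
  have hlim : Tendsto (fun k => Real.exp (-(elapsed b k - elapsed b K)) * max (|z K| - W) 0)
      atTop (𝓝 0) := by
    simpa [sub_eq_add_neg] using (Real.tendsto_exp_neg_atTop_nhds_zero.comp
      (tendsto_atTop_add_const_right _ (-elapsed b K) hb)).mul_const (max (|z K| - W) 0)
  filter_upwards [eventually_ge_atTop K, hlim.eventually_lt_const hη] with k hk h
  linarith [key k hk]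

end FictitiousPlay

/-! ### Model-based fictitious play -/

namespace MBFP

open FictitiousPlay

/-- The step size actually used at state `s` and stage `k`, which vanishes if `s` is not visited. -/
noncomputable def visitStep (G : MBFP S A1 A2) (f : ℕ → ℝ) (s : S) (k : ℕ) : ℝ :=
  if s = G.st k then f (G.cnt s k) else 0

variable (G : MBFP S A1 A2)

lemma cnt_succ (s : S) (k : ℕ) : G.cnt s (k + 1) = G.cnt s k + if s = G.st k then 1 else 0 := by
  unfold cnt
  rw [Finset.range_add_one, Finset.filter_insert]
  by_cases h : G.st k = s
  · rw [if_pos h, if_pos h.symm, Finset.card_insert_of_notMem (by simp)]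
  · rw [if_neg h, if_neg (Ne.symm h), add_zero]

lemma elapsed_visitStep (f : ℕ → ℝ) (s : S) (n : ℕ) :
    elapsed (G.visitStep f s) n = ∑ c ∈ Finset.range (G.cnt s n), f c := by
  induction n with
  | zero => simp [elapsed, cnt]
  | succ n ih =>
    rw [elapsed_succ, ih, cnt_succ, visitStep]
    split_ifs
    · rw [Finset.sum_range_succ]
    · simp

lemma tendsto_elapsed_visitStep {f : ℕ → ℝ} {s : S} (hs : Tendsto (fun k => G.cnt s k) atTop atTop)
    (hf : Tendsto (fun n => ∑ c ∈ Finset.range n, f c) atTop atTop) :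
    Tendsto (elapsed (G.visitStep f s)) atTop atTop := by
  rw [funext (G.elapsed_visitStep f s)]
  exact hf.comp hs

lemma visitStep_mem_Icc {f : ℕ → ℝ} (hf : ∀ c, f c ∈ Set.Ioc (0 : ℝ) 1) (s : S) (k : ℕ) :
    G.visitStep f s k ∈ Set.Icc (0 : ℝ) 1 := by
  unfold visitStep
  split_ifs
  · exact ⟨(hf _).1.le, (hf _).2⟩
  · simp

lemma tendsto_visitStep {f : ℕ → ℝ} {s : S} (hs : Tendsto (fun k => G.cnt s k) atTop atTop)
    (hf : ∀ c, f c ∈ Set.Ioc (0 : ℝ) 1) (h0 : Tendsto f atTop (𝓝 0)) :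
    Tendsto (G.visitStep f s) atTop (𝓝 0) := by
  refine squeeze_zero (fun k => (G.visitStep_mem_Icc hf s k).1) (fun k => ?_) (h0.comp hs)
  unfold visitStep
  split_ifs
  · exact le_rfl
  · exact (hf _).1.le

lemma visitStep_β (s : S) (k : ℕ) :
    G.visitStep G.β s k = G.β (G.cnt s k) / G.α (G.cnt s k) * G.visitStep G.α s k := by
  unfold visitStep
  split_ifs
  · rw [div_mul_cancel₀ _ (G.α_mem _).1.ne']
  · simp

/-- Player 2's belief on its own Q-function, seen from the side of player 2. -/
def Q2t (s : S) (k : ℕ) (b : A2) (a : A1) : ℝ := G.Q2 s k a b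

lemma vhat1_eq (k : ℕ) (s : S) : G.vhat1 k s = bestValue (G.Q1 s k) (G.π2 s k) := rfl

lemma vhat2_eq (k : ℕ) (s : S) : G.vhat2 k s = bestValue (G.Q2t s k) (G.π1 s k) := by
  simp only [vhat2, bestValue, Q2t, mul_comm]

lemma val1_eq (s : S) (k : ℕ) : val1 (G.Q1 s k) = minimaxValue (G.Q1 s k) := rfl

lemma val2_eq (s : S) (k : ℕ) : val2 (G.Q2 s k) = minimaxValue (G.Q2t s k) := by
  unfold val2 minimaxValue bestValue Q2t
  simp only [mul_comm]

lemma Q1_succ (s : S) (k : ℕ) (a : A1) (b : A2) :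
    G.Q1 s (k + 1) a b = G.Q1 s k a b + G.visitStep G.β s k *
      (G.r1 s a b + G.γ * ∑ s', G.vhat1 k s' * G.p s a b s' - G.Q1 s k a b) :=
  congrFun (congrFun (G.Q1_upd s k) a) b

lemma Q2t_succ (s : S) (k : ℕ) (b : A2) (a : A1) :
    G.Q2t s (k + 1) b a = G.Q2t s k b a + G.visitStep G.β s k *
      (G.r2 s a b + G.γ * ∑ s', G.vhat2 k s' * G.p s a b s' - G.Q2t s k b a) :=
  congrFun (congrFun (G.Q2_upd s k) a) b

lemma abs_discount_mul_sum_le {v μ : S → ℝ} {C : ℝ} (hv : ∀ s, |v s| ≤ C)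
    (hμ : μ ∈ stdSimplex ℝ S) : |G.γ * ∑ s', v s' * μ s'| ≤ G.γ * C := by
  rw [abs_mul, abs_of_nonneg G.γ_nonneg]
  exact mul_le_mul_of_nonneg_left (abs_sum_mul_le_of_mem_stdSimplex hv hμ) G.γ_nonneg

lemma p_mem_stdSimplex (s : S) (a : A1) (b : A2) : G.p s a b ∈ stdSimplex ℝ S :=
  ⟨G.p_nonneg s a b, G.p_sum_one s a b⟩

lemma exists_bound : ∃ C, (∀ s a b, |G.r1 s a b| ≤ C - G.γ * C) ∧
    (∀ s a b, |G.r2 s a b| ≤ C - G.γ * C) ∧ 0 ≤ C := by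
  have hγ : 0 < 1 - G.γ := sub_pos.2 G.γ_lt_one
  obtain ⟨R₁, h₁⟩ := (Set.finite_range fun x : S × A1 × A2 => |G.r1 x.1 x.2.1 x.2.2|).bddAbove
  obtain ⟨R₂, h₂⟩ := (Set.finite_range fun x : S × A1 × A2 => |G.r2 x.1 x.2.1 x.2.2|).bddAbove
  set R := max (max R₁ R₂) 0
  have hR : R / (1 - G.γ) - G.γ * (R / (1 - G.γ)) = R := by field_simp
  refine ⟨R / (1 - G.γ), fun s a b => ?_, fun s a b => ?_, div_nonneg (le_max_right _ _) hγ.le⟩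
  · rw [hR]
    exact (h₁ (Set.mem_range_self (s, a, b))).trans ((le_max_left _ _).trans (le_max_left _ _))
  · rw [hR]
    exact (h₂ (Set.mem_range_self (s, a, b))).trans ((le_max_right _ _).trans (le_max_left _ _))

lemma abs_average_le {x y t C : ℝ} (ht : t ∈ Set.Icc (0 : ℝ) 1) (hx : |x| ≤ C) (hy : |y| ≤ C) :
    |x + t * (y - x)| ≤ C := by
  rw [abs_le] at *
  constructor <;> nlinarith [ht.1, ht.2]

/-- Beliefs on Q-functions which are averaged with bounded targets stay bounded and are slow
compared to the beliefs on strategies. -/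
lemma bounded_and_isSlow (h : G.Assumption1) {A B : Type} [Fintype A] [Fintype B] [Nonempty A]
    {Q : S → ℕ → A → B → ℝ} {π : S → ℕ → B → ℝ} {r : S → A → B → ℝ} {p : S → A → B → S → ℝ}
    {C : ℝ} (hC : 0 ≤ C) (hr : ∀ s a b, |r s a b| ≤ C - G.γ * C)
    (hp : ∀ s a b, p s a b ∈ stdSimplex ℝ S) (hπ : ∀ s k, π s k ∈ stdSimplex ℝ B)
    (hstart : ∀ s, Q s 0 = r s)
    (hQ : ∀ s k a b, Q s (k + 1) a b = Q s k a b + G.visitStep G.β s k *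
      (r s a b + G.γ * ∑ s', bestValue (Q s' k) (π s' k) * p s a b s' - Q s k a b)) :
    (∀ s k a b, |Q s k a b| ≤ C) ∧ ∀ s, IsSlow (G.visitStep G.α s) (Q s) := by
  have htarget : ∀ k, (∀ s a b, |Q s k a b| ≤ C) → ∀ s a b,
      |r s a b + G.γ * ∑ s', bestValue (Q s' k) (π s' k) * p s a b s'| ≤ C := by
    intro k hk s a b
    have h1 := G.abs_discount_mul_sum_le
      (fun s' => abs_bestValue_le (hk s') (hπ s' k)) (hp s a b)
    linarith [abs_add_le (r s a b) (G.γ * ∑ s', bestValue (Q s' k) (π s' k) * p s a b s'),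
      hr s a b]
  have hbound : ∀ k s a b, |Q s k a b| ≤ C := by
    intro k
    induction k with
    | zero =>
      intro s a b
      rw [hstart]
      linarith [hr s a b, mul_nonneg G.γ_nonneg hC]
    | succ k ih =>
      intro s a b
      rw [hQ]
      exact abs_average_le (G.visitStep_mem_Icc G.β_mem s k) (ih s a b) (htarget k ih s a b)
  refine ⟨fun s k => hbound k s, fun s => ⟨⟨C, fun k => hbound k s⟩,
    fun k => 2 * C * (G.β (G.cnt s k) / G.α (G.cnt s k)), ?_, fun k a b => ?_⟩⟩
  · simpa using ((h.2.2.2.2.2).comp (h.1 s)).const_mul (2 * C)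
  · have h1 := abs_sub (r s a b + G.γ * ∑ s', bestValue (Q s' k) (π s' k) * p s a b s') (Q s k a b)
    have h2 := htarget k (hbound k) s a b
    have h3 := hbound k s a b
    rw [hQ, add_sub_cancel_left, abs_mul, abs_of_nonneg (G.visitStep_mem_Icc G.β_mem s k).1,
      mul_assoc, ← visitStep_β, mul_comm]
    exact mul_le_mul_of_nonneg_right (by linarith) (G.visitStep_mem_Icc G.β_mem s k).1

lemma isReinforced_π1 (s : S) : IsReinforced (G.visitStep G.α s) G.astar1 (G.π1 s) :=
  ⟨G.π1_simplex s, fun k => congrFun (G.π1_upd s k)⟩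

lemma isReinforced_π2 (s : S) : IsReinforced (G.visitStep G.α s) G.astar2 (G.π2 s) :=
  ⟨G.π2_simplex s, fun k => congrFun (G.π2_upd s k)⟩

lemma isBestResponse_astar1 (s : S) :
    IsBestResponse (G.visitStep G.α s) G.astar1 (G.Q1 s) (G.π2 s) := by
  intro k hk a
  obtain rfl : s = G.st k := by
    by_contra hne
    exact hk (if_neg hne)
  exact G.astar1_br k a

lemma isBestResponse_astar2 (s : S) :
    IsBestResponse (G.visitStep G.α s) G.astar2 (G.Q2t s) (G.π1 s) := by
  intro k hk b
  obtain rfl : s = G.st k := by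
    by_contra hne
    exact hk (if_neg hne)
  simpa only [Q2t, mul_comm] using G.astar2_br k b

/-- The deviation of the beliefs on Q-functions from being zero-sum. -/
noncomputable def zeroSumGap (s : S) (k : ℕ) : ℝ := maxNorm fun a b => G.Q1 s k a b + G.Q2t s k b a

lemma abs_le_zeroSumGap (s : S) (k : ℕ) (a : A1) (b : A2) :
    |G.Q1 s k a b + G.Q2t s k b a| ≤ G.zeroSumGap s k :=
  abs_le_maxNorm (fun a b => G.Q1 s k a b + G.Q2t s k b a) a b

variable {G}

lemma exists_bound_and_isSlow (h : G.Assumption1) :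
    (∃ C, ∀ s k, G.zeroSumGap s k ≤ C) ∧ ∀ s, IsSlow (G.visitStep G.α s) (G.Q1 s) ∧
      IsSlow (G.visitStep G.α s) (G.Q2t s) := by
  obtain ⟨C, hr1, hr2, hC⟩ := G.exists_bound
  have hQ1 := G.bounded_and_isSlow h hC hr1 G.p_mem_stdSimplex G.π2_simplex G.Q1_init G.Q1_succ
  have hQ2 := G.bounded_and_isSlow (Q := G.Q2t) (π := G.π1) (r := fun s b a => G.r2 s a b)
    (p := fun s b a => G.p s a b) h hC (fun s b a => hr2 s a b)
    (fun s b a => G.p_mem_stdSimplex s a b) G.π1_simplex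
    (fun s => by ext b a; simp only [Q2t, G.Q2_init])
    (fun s k b a => by simp only [← vhat2_eq]; exact G.Q2t_succ s k b a)
  exact ⟨⟨C + C, fun s k => maxNorm_le fun a b =>
    (abs_add_le _ _).trans (add_le_add (hQ1.1 s k a b) (hQ2.1 s k b a))⟩,
    fun s => ⟨hQ1.2 s, hQ2.2 s⟩⟩

lemma eventually_vhat_add_le (h : G.Assumption1) (s : S) {η : ℝ} (hη : 0 < η) :
    ∀ᶠ k in atTop, G.vhat1 k s + G.vhat2 k s ≤ G.zeroSumGap s k + η := by
  obtain ⟨hQ1, hQ2⟩ := (exists_bound_and_isSlow h).2 s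
  simp only [vhat1_eq, vhat2_eq]
  exact eventually_bestValue_add_le (fun k => (G.visitStep_mem_Icc G.α_mem s k).1)
    (G.tendsto_elapsed_visitStep (h.1 s) h.2.1) (G.tendsto_visitStep (h.1 s) G.α_mem h.2.2.2.1)
    (G.isReinforced_π1 s) (G.isReinforced_π2 s) (G.isBestResponse_astar1 s)
    (G.isBestResponse_astar2 s) hQ1 hQ2 hη

lemma abs_vhat_add_le {s : S} {k : ℕ} {η : ℝ} (hη : 0 < η)
    (h : G.vhat1 k s + G.vhat2 k s ≤ G.zeroSumGap s k + η) :
    |G.vhat1 k s + G.vhat2 k s| ≤ G.zeroSumGap s k + η := by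
  have := neg_le_bestValue_add (G.abs_le_zeroSumGap s k) (G.π1_simplex s k) (G.π2_simplex s k)
  rw [← vhat1_eq, ← vhat2_eq] at this
  rw [abs_le]
  constructor <;> linarith

/-- One round of the asynchronous contraction. -/
lemma eventually_zeroSumGap_le_mul (h : G.Assumption1) {D : ℝ} (hD : 0 < D)
    (hev : ∀ᶠ k in atTop, ∀ s, G.zeroSumGap s k ≤ D) :
    ∀ᶠ k in atTop, ∀ s, G.zeroSumGap s k ≤ (1 + G.γ) / 2 * D := by
  have hγ0 := G.γ_nonneg
  have hγ1 := G.γ_lt_one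
  have hη : 0 < (1 - G.γ) / 4 * D := mul_pos (by linarith) hD
  have hv : ∀ᶠ k in atTop, ∀ s, |G.vhat1 k s + G.vhat2 k s| ≤ D + (1 - G.γ) / 4 * D := by
    filter_upwards [hev, eventually_all.2 fun s => eventually_vhat_add_le h s hη] with k h1 h2 s
    linarith [abs_vhat_add_le hη (h2 s), h1 s]
  have hentry : ∀ s a b, ∀ᶠ k in atTop,
      |G.Q1 s k a b + G.Q2t s k b a| ≤ (1 + G.γ) / 2 * D := by
    intro s a b
    have := eventually_abs_le_of_averaging (η := (1 - G.γ) / 4 * D)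
      (z := fun k => G.Q1 s k a b + G.Q2t s k b a)
      (w := fun k => G.γ * ∑ s', (G.vhat1 k s' + G.vhat2 k s') * G.p s a b s')
      (fun k => (G.visitStep_mem_Icc G.β_mem s k).1) (fun k => (G.visitStep_mem_Icc G.β_mem s k).2)
      (G.tendsto_elapsed_visitStep (h.1 s) h.2.2.1)
      (fun k => by
        simp only [Q1_succ, Q2t_succ, add_mul, Finset.sum_add_distrib]
        linear_combination G.visitStep G.β s k * G.zerosum s a b)
      (hv.mono fun k hk => G.abs_discount_mul_sum_le hk (G.p_mem_stdSimplex s a b)) hη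
    filter_upwards [this] with k hk
    nlinarith
  filter_upwards [eventually_all.2 fun s => eventually_all.2 fun a => eventually_all.2 fun b =>
    hentry s a b] with k hk s
  exact maxNorm_le (hk s)

/-- The beliefs on Q-functions become zero-sum. -/
lemma eventually_zeroSumGap_le (h : G.Assumption1) {η : ℝ} (hη : 0 < η) :
    ∀ᶠ k in atTop, ∀ s, G.zeroSumGap s k ≤ η := by
  obtain ⟨C, hC⟩ := (exists_bound_and_isSlow h).1
  have hγ0 := G.γ_nonneg
  have hγ1 := G.γ_lt_one
  have hD : 0 < max C 1 := lt_max_of_lt_right one_pos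
  have hρ : 0 < (1 + G.γ) / 2 := by linarith
  have hpow : ∀ n : ℕ, ∀ᶠ k in atTop, ∀ s, G.zeroSumGap s k ≤ ((1 + G.γ) / 2) ^ n * max C 1 := by
    intro n
    induction n with
    | zero => exact Eventually.of_forall fun k s => by simpa using Or.inl (hC s k)
    | succ n ih =>
      rw [pow_succ', mul_assoc]
      exact eventually_zeroSumGap_le_mul h (by positivity) ih
  have hlim := (tendsto_pow_atTop_nhds_zero_of_lt_one hρ.le (by linarith)).mul_const (max C 1)
  rw [zero_mul] at hlim
  obtain ⟨n, hn⟩ := (hlim.eventually_le_const hη).exists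
  exact (hpow n).mono fun k hk s => (hk s).trans hn

lemma tendsto_vhat_add_zeroSumGap (h : G.Assumption1) (s : S) :
    Tendsto (fun k => G.vhat1 k s + G.vhat2 k s + G.zeroSumGap s k) atTop (𝓝 0) := by
  rw [Metric.tendsto_nhds]
  intro η hη
  have hη' : 0 < η / 4 := by positivity
  filter_upwards [eventually_zeroSumGap_le h hη', eventually_vhat_add_le h s hη'] with k h1 h2
  have h3 := abs_le.1 (abs_vhat_add_le hη' h2)
  have h4 := (abs_nonneg _).trans
    (G.abs_le_zeroSumGap s k (Classical.arbitrary A1) (Classical.arbitrary A2))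
  have h5 := h1 s
  rw [Real.dist_eq, sub_zero, abs_lt]
  constructor <;> linarith

end MBFP

/-- Lemma 6 of Sayin–Parise–Ozdaglar: the estimates of continuation payoffs track the
minimax values associated with the beliefs on `Q`-functions. -/
theorem v_estimates_track_minimax (G : MBFP S A1 A2) (h : G.Assumption1) (s : S) :
    Tendsto (fun k => G.vhat1 k s - val1 (G.Q1 s k)) atTop (𝓝 0) ∧
    Tendsto (fun k => G.vhat2 k s - val2 (G.Q2 s k)) atTop (𝓝 0) := by
  have hlim := MBFP.tendsto_vhat_add_zeroSumGap h s
  constructor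
  · refine squeeze_zero (fun k => ?_) (fun k => ?_) hlim
    · rw [G.vhat1_eq, G.val1_eq, sub_nonneg]
      exact FictitiousPlay.minimaxValue_le_bestValue _ (G.π2_simplex s k)
    · rw [G.val1_eq, G.vhat1_eq, G.vhat2_eq]
      exact FictitiousPlay.bestValue_sub_minimaxValue_le (G.abs_le_zeroSumGap s k)
        (G.π1_simplex s k) (G.π2_simplex s k)
  · refine squeeze_zero (fun k => ?_) (fun k => ?_) hlim
    · rw [G.vhat2_eq, G.val2_eq, sub_nonneg]
      exact FictitiousPlay.minimaxValue_le_bestValue _ (G.π1_simplex s k)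
    · rw [G.vhat2_eq, G.val2_eq, G.vhat1_eq, add_comm (FictitiousPlay.bestValue (G.Q1 s k) _)]
      refine FictitiousPlay.bestValue_sub_minimaxValue_le (fun b a => ?_)
        (G.π2_simplex s k) (G.π1_simplex s k)
      rw [add_comm]
      exact G.abs_le_zeroSumGap s k a b
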